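/- Under the correlative sparsity assumption, let ρ^cs be the infimum of ∑_{i=1}^N ∫_{K_i} p_i dμ_i over all tuples of finite positive Borel measures μ_i supported on K_i that are invariant under the sign-flip maps σ_r (restricted to the coordinates I_i) for every r ∈ R, subject to ∫_{K_i} q_i dμ_i = 1 for all i = 1,…,N and the marginal constraints that the pushforward of the measure q_i·μ_i onto the coordinates I_i ∩ I_j equals the pushforward of q_j·μ_j onto the coordinates I_i ∩ I_j, for all j ∈ U_i and i = 1,…,N−1. Then ρ^cs = ρ = inf_{x∈K} ∑_{i=1}^N p_i(x)/q_i(x). -/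

import Mathlib

open MvPolynomial MeasureTheory

noncomputable section

/-- Parity pairing `r·α = ∑ᵢ rᵢ αᵢ` between `r ∈ {0,1}ⁿ` and an exponent vector `α`. -/
def dotPar {n : ℕ} (r : Fin n → Fin 2) (α : Fin n →₀ ℕ) : ℕ :=
  ∑ i, (r i : ℕ) * α i

/-- Sign symmetries `R(A) = {r ∈ {0,1}ⁿ : r·α ≡ 0 (mod 2) ∀ α ∈ A}`. -/
def signSyms {n : ℕ} (A : Finset (Fin n →₀ ℕ)) : Finset (Fin n → Fin 2) :=
  Finset.univ.filter fun r => ∀ α ∈ A, 2 ∣ dotPar r α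

/-- Extension by zero of a point of `ℝ^{I}` to a point of `ℝⁿ`. -/
def extendZero {n : ℕ} (S : Finset (Fin n)) (y : {l : Fin n // l ∈ S} → ℝ) :
    Fin n → ℝ :=
  fun l => if h : l ∈ S then y ⟨l, h⟩ else 0

/-- The sign-flip map `σ_r` acting on `ℝ^{I}` (coordinates restricted to `S`). -/
def flipOn {n : ℕ} (S : Finset (Fin n)) (r : Fin n → Fin 2)
    (y : {l : Fin n // l ∈ S} → ℝ) : {l : Fin n // l ∈ S} → ℝ :=
  fun l => (-1 : ℝ) ^ (r l.1 : ℕ) * y l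

/-- Projection `ℝ^{S} → ℝ^{T}` for `T ⊆ S`. -/
def restrTo {n : ℕ} (S T : Finset (Fin n)) (h : T ⊆ S)
    (y : {l : Fin n // l ∈ S} → ℝ) : {l : Fin n // l ∈ T} → ℝ :=
  fun l => y ⟨l.1, h l.2⟩

/-! ### Coordinates, evaluation and sign flips -/

/-- The sign-flip map `σ_r` on `ℝⁿ`. -/
def signFlip {n : ℕ} (r : Fin n → Fin 2) (x : Fin n → ℝ) : Fin n → ℝ :=
  fun l => (-1 : ℝ) ^ (r l : ℕ) * x l

lemma continuous_extendZero {n : ℕ} (S : Finset (Fin n)) : Continuous (extendZero S) := by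
  refine continuous_pi fun l => ?_
  unfold extendZero
  split_ifs
  · exact continuous_apply _
  · exact continuous_const

lemma continuous_eval_extendZero {n : ℕ} (S : Finset (Fin n)) (f : MvPolynomial (Fin n) ℝ) :
    Continuous fun y => eval (extendZero S y) f :=
  (MvPolynomial.continuous_eval f).comp (continuous_extendZero S)

lemma measurable_restrTo {n : ℕ} (S T : Finset (Fin n)) (h : T ⊆ S) :
    Measurable (restrTo S T h) :=
  measurable_pi_lambda _ fun _ => measurable_pi_apply _

lemma measurable_flipOn {n : ℕ} (S : Finset (Fin n)) (r : Fin n → Fin 2) :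
    Measurable (flipOn S r) :=
  measurable_pi_lambda _ fun l => (measurable_pi_apply l).const_mul _

lemma measurable_signFlip {n : ℕ} (r : Fin n → Fin 2) : Measurable (signFlip r) :=
  measurable_pi_lambda _ fun l => (measurable_pi_apply l).const_mul _

/-- A polynomial in the variables of `S` only depends on the coordinates in `S`. -/
lemma eval_extendZero_restrict {n : ℕ} {S : Finset (Fin n)} {f : MvPolynomial (Fin n) ℝ}
    (hf : f.vars ⊆ S) (x : Fin n → ℝ) : eval (extendZero S (S.restrict x)) f = eval x f := by
  refine eval₂Hom_congr' rfl (fun l hl _ => ?_) rfl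
  simp [extendZero, hf hl]

lemma eval_signFlip {n : ℕ} {r : Fin n → Fin 2} {f : MvPolynomial (Fin n) ℝ}
    (h : ∀ α ∈ f.support, 2 ∣ dotPar r α) (x : Fin n → ℝ) :
    eval (signFlip r x) f = eval x f := by
  rw [eval_eq', eval_eq']
  refine Finset.sum_congr rfl fun α hα => ?_
  have h1 : ∏ i, ((-1 : ℝ) ^ (r i : ℕ)) ^ α i = 1 := by
    simp_rw [← pow_mul]
    rw [Finset.prod_pow_eq_pow_sum]
    exact (even_iff_two_dvd.mpr (h α hα)).neg_one_pow
  simp only [signFlip, mul_pow, Finset.prod_mul_distrib, h1, one_mul]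

lemma signFlip_add {n : ℕ} (s r : Fin n → Fin 2) (x : Fin n → ℝ) :
    signFlip s (signFlip r x) = signFlip (s + r) x := by
  funext l
  simp only [signFlip, Pi.add_apply]
  generalize s l = a
  generalize r l = b
  fin_cases a <;> fin_cases b <;> simp

lemma zero_mem_signSyms {n : ℕ} (A : Finset (Fin n →₀ ℕ)) : 0 ∈ signSyms A := by
  simp only [signSyms, Finset.mem_filter, Finset.mem_univ, true_and]
  simp [dotPar]

lemma add_mem_signSyms {n : ℕ} {A : Finset (Fin n →₀ ℕ)} {s r : Fin n → Fin 2}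
    (hs : s ∈ signSyms A) (hr : r ∈ signSyms A) : s + r ∈ signSyms A := by
  simp only [signSyms, Finset.mem_filter, Finset.mem_univ, true_and] at *
  intro α hα
  have h : dotPar (s + r) α ≡ dotPar s α + dotPar r α [MOD 2] := by
    unfold dotPar
    rw [← Finset.sum_add_distrib]
    refine Nat.ModEq.sum fun l _ => ?_
    rw [← add_mul, Pi.add_apply, Fin.val_add]
    exact (Nat.mod_modEq _ 2).mul_right _
  exact (h.dvd_iff dvd_rfl).mpr (dvd_add (hs α hα) (hr α hα))

lemma add_add_cancel_fin_two {n : ℕ} (s r : Fin n → Fin 2) : s + (s + r) = r := by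
  funext l
  simp only [Pi.add_apply]
  generalize s l = a
  generalize r l = b
  fin_cases a <;> fin_cases b <;> rfl

/-- The uniform measure on the orbit of a point under a group of sign flips. -/
lemma exists_invariant_orbit_measure {n : ℕ} (A : Finset (Fin n →₀ ℕ)) (x : Fin n → ℝ) :
    ∃ π : Measure (Fin n → ℝ), IsProbabilityMeasure π ∧
      (∀ᵐ y ∂π, ∃ r ∈ signSyms A, y = signFlip r x) ∧
      ∀ s ∈ signSyms A, π.map (signFlip s) = π := by
  set R := signSyms A
  have hcard : (R.card : ENNReal) ≠ 0 := by
    have : R.card ≠ 0 := Finset.card_ne_zero_of_mem (zero_mem_signSyms A)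
    exact_mod_cast this
  refine ⟨(R.card : ENNReal)⁻¹ • ∑ r ∈ R, Measure.dirac (signFlip r x), ⟨?_⟩, ?_, ?_⟩
  · simp [ENNReal.inv_mul_cancel hcard (ENNReal.natCast_ne_top _)]
  · refine Measure.ae_smul_measure ?_ _
    rw [ae_iff, Measure.finsetSum_apply]
    refine Finset.sum_eq_zero fun r hr => ?_
    rw [← ae_iff, ae_dirac_eq]
    exact ⟨r, hr, rfl⟩
  · intro s hs
    rw [Measure.map_smul, ← Measure.mapₗ_apply_of_measurable (measurable_signFlip s), map_sum]
    congr 1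
    simp_rw [Measure.mapₗ_apply_of_measurable (measurable_signFlip s),
      Measure.map_dirac' (measurable_signFlip s), signFlip_add]
    exact Finset.sum_nbij' (s + ·) (s + ·) (fun r hr => add_mem_signSyms hs hr)
      (fun r hr => add_mem_signSyms hs hr) (fun r _ => add_add_cancel_fin_two s r)
      (fun r _ => add_add_cancel_fin_two s r) (fun _ _ => rfl)

/-! ### Gluing of measures -/

/-- Two probability measures with the same image in `Z` are the marginals of a probability
measure concentrated on the fibre product over `Z`. -/
lemma exists_coupling_of_map_eq {X Y Z : Type*} [MeasurableSpace X] [MeasurableSpace Y]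
    [MeasurableSpace Z] [StandardBorelSpace Y] [MeasurableEq Z]
    (μ : Measure X) (ν : Measure Y) [IsProbabilityMeasure μ] [IsProbabilityMeasure ν]
    {f : X → Z} {h : Y → Z} (hf : Measurable f) (hh : Measurable h)
    (hfh : μ.map f = ν.map h) :
    ∃ γ : Measure (X × Y), IsProbabilityMeasure γ ∧ γ.map Prod.fst = μ ∧ γ.map Prod.snd = ν ∧
      ∀ᵐ z ∂γ, f z.1 = h z.2 := by
  have : Nonempty Y := nonempty_of_isProbabilityMeasure ν
  set κ := ProbabilityTheory.condDistrib id h ν with hκ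
  have hjoint : (μ.compProd (κ.comap f hf)).map (Prod.map f id) = ν.map fun y => (h y, y) := by
    have h1 := ProbabilityTheory.compProd_map_condDistrib (mβ := ‹MeasurableSpace Z›) (X := h) (μ := ν) (Y := id)
      aemeasurable_id
    rw [← hκ, ← hfh] at h1
    simp only [id] at h1
    rw [← h1]
    ext s hs
    have hm : Measurable (Prod.map f (id : Y → Y)) := by fun_prop
    rw [Measure.map_apply hm hs, Measure.compProd_apply (hm hs), Measure.compProd_apply hs,
      lintegral_map (ProbabilityTheory.Kernel.measurable_kernel_prodMk_left hs) hf]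
    rfl
  have hm : Measurable (Prod.map f (id : Y → Y)) := by fun_prop
  refine ⟨μ.compProd (κ.comap f hf), inferInstance, Measure.fst_compProd _ _, ?_, ?_⟩
  · have h2 := congrArg (Measure.map Prod.snd) hjoint
    rw [Measure.map_map measurable_snd hm, Measure.map_map measurable_snd (by fun_prop)] at h2
    simpa [Function.comp_def] using h2
  · have hs : MeasurableSet {z : Z × Y | z.1 = h z.2} :=
      measurableSet_eq_fun measurable_fst (hh.comp measurable_snd)
    have h3 : ∀ᵐ z ∂(ν.map fun y => (h y, y)), z.1 = h z.2 := by
      rw [ae_map_iff (by fun_prop) hs]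
      simp
    rw [← hjoint, ae_map_iff hm.aemeasurable hs] at h3
    exact h3

/-- Probability measures on the coordinate spaces of a family of index sets with the running
intersection property are the marginals of one probability measure as soon as their pairwise
marginals agree. -/
lemma exists_measure_of_running_intersection {n N : ℕ} (I : Fin N → Finset (Fin n))
    (hRIP : ∀ i : Fin N, 0 < (i : ℕ) → ∃ k : Fin N, (k : ℕ) < (i : ℕ) ∧
      I i ∩ (Finset.univ.filter fun j : Fin N => (j : ℕ) < (i : ℕ)).biUnion I ⊆ I k)
    (ν : (i : Fin N) → Measure ({l : Fin n // l ∈ I i} → ℝ))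
    [∀ i, IsProbabilityMeasure (ν i)]
    (hν : ∀ i j : Fin N, i < j → (I i ∩ I j).Nonempty →
      (ν i).map (restrTo (I i) (I i ∩ I j) Finset.inter_subset_left) =
        (ν j).map (restrTo (I j) (I i ∩ I j) Finset.inter_subset_right)) :
    ∃ π : Measure (Fin n → ℝ), IsProbabilityMeasure π ∧ ∀ i, π.map (I i).restrict = ν i := by
  suffices h : ∀ k ≤ N, ∃ π : Measure (Fin n → ℝ), IsProbabilityMeasure π ∧
      ∀ i : Fin N, (i : ℕ) < k → π.map (I i).restrict = ν i by
    obtain ⟨π, hπ, hm⟩ := h N le_rfl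
    exact ⟨π, hπ, fun i => hm i i.2⟩
  have hrestr (S : Finset (Fin n)) :
      Measurable (S.restrict : (Fin n → ℝ) → ({l : Fin n // l ∈ S} → ℝ)) :=
    Finset.measurable_restrict S
  intro k
  induction k with
  | zero => exact fun _ => ⟨Measure.dirac 0, inferInstance, fun i hi => absurd hi (by simp)⟩
  | succ k ih =>
    intro hk
    obtain ⟨π, hπ, hm⟩ := ih (by omega)
    set c : Fin N := ⟨k, by omega⟩ with hc
    rcases Nat.eq_zero_or_pos k with rfl | hkpos
    · have hext := (continuous_extendZero (I c)).measurable
      refine ⟨(ν c).map (extendZero (I c)), Measure.isProbabilityMeasure_map hext.aemeasurable, ?_⟩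
      intro i hi
      obtain rfl : i = c := Fin.ext (by simp [hc]; omega)
      rw [Measure.map_map (hrestr _) hext]
      convert Measure.map_id
      funext y l
      simp [extendZero]
    · obtain ⟨b, hb, hsub⟩ := hRIP c hkpos
      have hagree : π.map ((I b ∩ I c).restrict) =
          (ν c).map (restrTo (I c) (I b ∩ I c) Finset.inter_subset_right) := by
        have hfac : ((I b ∩ I c).restrict : (Fin n → ℝ) → _) =
            restrTo (I b) (I b ∩ I c) Finset.inter_subset_left ∘ (I b).restrict := rfl
        rw [hfac, ← Measure.map_map (measurable_restrTo _ _ _) (hrestr _), hm b hb]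
        rcases (I b ∩ I c).eq_empty_or_nonempty with he | hne
        · have : IsEmpty {l : Fin n // l ∈ I b ∩ I c} := ⟨fun l => by simpa [he] using l.2⟩
          have h1 := Measure.isProbabilityMeasure_map (μ := ν b)
            (measurable_restrTo (I b) (I b ∩ I c) Finset.inter_subset_left).aemeasurable
          have h2 := Measure.isProbabilityMeasure_map (μ := ν c)
            (measurable_restrTo (I c) (I b ∩ I c) Finset.inter_subset_right).aemeasurable
          ext s hs
          rcases s.eq_empty_or_nonempty with rfl | hs'
          · simp
          · rw [Subsingleton.eq_univ_of_nonempty hs', measure_univ, measure_univ]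
        · exact hν b c hb hne
      obtain ⟨γ, hγ, hfst, hsnd, hae⟩ := exists_coupling_of_map_eq π (ν c) (hrestr _)
        (measurable_restrTo (I c) (I b ∩ I c) Finset.inter_subset_right) hagree
      set merge : (Fin n → ℝ) × ({l : Fin n // l ∈ I c} → ℝ) → (Fin n → ℝ) :=
        fun z l => if h : l ∈ I c then z.2 ⟨l, h⟩ else z.1 l with hmerge
      have hmeas : Measurable merge := by
        refine measurable_pi_lambda _ fun l => ?_
        simp only [hmerge]
        split_ifs
        · exact (measurable_pi_apply _).comp measurable_snd
        · exact (measurable_pi_apply _).comp measurable_fst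
      refine ⟨γ.map merge, Measure.isProbabilityMeasure_map hmeas.aemeasurable, fun i hi => ?_⟩
      rw [Measure.map_map (hrestr _) hmeas]
      rcases Nat.lt_succ_iff_lt_or_eq.mp hi with hlt | heq
      · rw [← hm i hlt, ← hfst, Measure.map_map (hrestr _) measurable_fst]
        refine Measure.map_congr ?_
        filter_upwards [hae] with z hz
        funext l
        by_cases hl : (l : Fin n) ∈ I c
        · have hlb : (l : Fin n) ∈ I b := hsub (Finset.mem_inter.mpr ⟨hl, Finset.mem_biUnion.mpr
            ⟨i, by simpa [hc] using hlt, l.2⟩⟩)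
          have := congrFun hz ⟨l, Finset.mem_inter.mpr ⟨hlb, hl⟩⟩
          simpa [hmerge, hl, restrTo] using this.symm
        · simp [hmerge, hl]
      · obtain rfl : i = c := Fin.ext heq
        conv_rhs => rw [← hsnd]
        congr 1
        funext z l
        simp [hmerge]

/-! ### Densities and the feasible sets -/

/-- Integration against `μ` with density `Q` turns `∫ P dμ` into the integral of `P / Q`. -/
lemma withDensity_integral_div {X : Type*} [TopologicalSpace X] [MeasurableSpace X]
    [BorelSpace X] {μ : Measure X} {K : Set X} (hK : IsCompact K)
    (hμ : μ Kᶜ = 0) {P Q : X → ℝ} (hP : Continuous P) (hQ : Continuous Q)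
    (hpos : ∀ y ∈ K, 0 < Q y) (hone : ∫ y, Q y ∂μ = 1) :
    IsProbabilityMeasure (μ.withDensity fun y => ENNReal.ofReal (Q y)) ∧
      (∀ᵐ y ∂(μ.withDensity fun y => ENNReal.ofReal (Q y)), y ∈ K) ∧
      Integrable (fun y => P y / Q y) (μ.withDensity fun y => ENNReal.ofReal (Q y)) ∧
      ∫ y, P y / Q y ∂(μ.withDensity fun y => ENNReal.ofReal (Q y)) = ∫ y, P y ∂μ := by
  have hae : ∀ᵐ y ∂μ, y ∈ K := hμ
  have hint : Integrable Q μ := by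
    by_contra h
    simp [integral_undef h] at hone
  have hprob : IsProbabilityMeasure (μ.withDensity fun y => ENNReal.ofReal (Q y)) := by
    refine ⟨?_⟩
    rw [withDensity_apply _ MeasurableSet.univ, Measure.restrict_univ,
      ← ofReal_integral_eq_lintegral_ofReal hint, hone, ENNReal.ofReal_one]
    filter_upwards [hae] with y hy using (hpos y hy).le
  have hae' : ∀ᵐ y ∂(μ.withDensity fun y => ENNReal.ofReal (Q y)), y ∈ K :=
    (withDensity_absolutelyContinuous μ _).ae_le hae
  refine ⟨hprob, hae', ?_, ?_⟩
  · have hcont : ContinuousOn (fun y => P y / Q y) K :=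
      hP.continuousOn.div hQ.continuousOn fun y hy => (hpos y hy).ne'
    obtain ⟨C, hC⟩ := hK.exists_bound_of_continuousOn hcont
    refine Integrable.of_bound (hP.measurable.div hQ.measurable).aestronglyMeasurable C ?_
    filter_upwards [hae'] with y hy using hC y hy
  · rw [integral_withDensity_eq_integral_toReal_smul hQ.measurable.ennreal_ofReal
      (Filter.Eventually.of_forall fun _ => ENNReal.ofReal_lt_top)]
    refine integral_congr_ae ?_
    filter_upwards [hae] with y hy
    have := hpos y hy
    rw [ENNReal.toReal_ofReal this.le, smul_eq_mul, mul_div_cancel₀ _ this.ne']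

lemma isClosed_feasible {n m : ℕ} (g : Fin m → MvPolynomial (Fin n) ℝ) (S : Finset (Fin n))
    (J : Finset (Fin m)) :
    IsClosed {y : {l : Fin n // l ∈ S} → ℝ | ∀ j ∈ J, 0 ≤ eval (extendZero S y) (g j)} := by
  simp only [Set.ofPred_forall]
  exact isClosed_iInter fun j => isClosed_iInter fun _ =>
    isClosed_le continuous_const (continuous_eval_extendZero S (g j))

/-- The ball constraint makes the feasible set compact. -/
lemma isCompact_feasible {n m : ℕ} (g : Fin m → MvPolynomial (Fin n) ℝ) (S : Finset (Fin n))
    (J : Finset (Fin m)) (hball : ∃ j ∈ J, ∃ M : ℝ, 0 < M ∧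
      g j = MvPolynomial.C M - ∑ l ∈ S, MvPolynomial.X l ^ 2) :
    IsCompact {y : {l : Fin n // l ∈ S} → ℝ | ∀ j ∈ J, 0 ≤ eval (extendZero S y) (g j)} := by
  obtain ⟨j, hj, M, -, hgj⟩ := hball
  refine (isCompact_univ_pi fun _ : {l : Fin n // l ∈ S} =>
    isCompact_Icc (a := -√M) (b := √M)).of_isClosed_subset (isClosed_feasible g S J) ?_
  intro y hy l _
  have h := hy j hj
  simp only [hgj, map_sub, eval_C, map_sum, map_pow, eval_X] at h
  have hl : extendZero S y l ^ 2 ≤ ∑ k ∈ S, extendZero S y k ^ 2 :=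
    Finset.single_le_sum (f := fun k => extendZero S y k ^ 2) (fun _ _ => sq_nonneg _) l.2
  have hyl : extendZero S y l = y l := by simp [extendZero]
  rw [hyl] at hl
  exact abs_le.mp (Real.abs_le_sqrt (by linarith))

lemma sInf_eq_of_subset_of_forall_le {S T : Set ℝ} (hT : T.Nonempty) (hTS : T ⊆ S)
    (hS : ∀ v ∈ S, sInf T ≤ v) : sInf S = sInf T :=
  le_antisymm (csInf_le_csInf ⟨_, hS⟩ hT hTS) (le_csInf (hT.mono hTS) hS)

/-- Under the correlative sparsity assumption, the optimal value
`ρ^cs` of the sign symmetry adapted sparse GMP (CSP) — over tuples of finite positive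
Borel measures `μ_i` supported on `K_i`, invariant under all sign flips `σ_r`, `r ∈ R`,
with `∫ q_i dμ_i = 1` and matching marginals of `q_i·μ_i` on the shared variables —
equals `ρ = inf_{x ∈ K} ∑_i p_i(x)/q_i(x)`.
(Index `i < j` ranges over the pairs `j ∈ U_i`.) -/
theorem stmt_15 (n m N : ℕ)
    (g : Fin m → MvPolynomial (Fin n) ℝ) (p q : Fin N → MvPolynomial (Fin n) ℝ)
    (I : Fin N → Finset (Fin n)) (J : Fin N → Finset (Fin m))
    (hIcover : ∀ l : Fin n, ∃ i, l ∈ I i)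
    (hJcover : ∀ j : Fin m, ∃ i, j ∈ J i)
    (hp : ∀ i, (p i).vars ⊆ I i) (hqv : ∀ i, (q i).vars ⊆ I i)
    (hg : ∀ i, ∀ j ∈ J i, (g j).vars ⊆ I i)
    (hball : ∀ i, ∃ j ∈ J i, ∃ M : ℝ, 0 < M ∧
      g j = MvPolynomial.C M - ∑ l ∈ I i, MvPolynomial.X l ^ 2)
    (hRIP : ∀ i : Fin N, 0 < (i : ℕ) → ∃ k : Fin N, (k : ℕ) < (i : ℕ) ∧
      I i ∩ (Finset.univ.filter fun j : Fin N => (j : ℕ) < (i : ℕ)).biUnion I ⊆ I k)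
    (hqpos : ∀ i, ∀ y : {l : Fin n // l ∈ I i} → ℝ,
      (∀ j ∈ J i, 0 ≤ eval (extendZero (I i) y) (g j)) →
      0 < eval (extendZero (I i) y) (q i))
    (hKne : {x : Fin n → ℝ | ∀ j, 0 ≤ eval x (g j)}.Nonempty) :
    sInf {v : ℝ | ∃ μ : (i : Fin N) → Measure ({l : Fin n // l ∈ I i} → ℝ),
        (∀ i, IsFiniteMeasure (μ i)) ∧
        (∀ i, μ i {y | ∀ j ∈ J i, 0 ≤ eval (extendZero (I i) y) (g j)}ᶜ = 0) ∧
        (∀ i, ∀ r ∈ signSyms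
            ((Finset.univ.biUnion fun i' : Fin N => (p i').support ∪ (q i').support) ∪
              Finset.univ.biUnion fun j => (g j).support),
          (μ i).map (flipOn (I i) r) = μ i) ∧
        (∀ i, ∫ y, eval (extendZero (I i) y) (q i) ∂(μ i) = 1) ∧
        (∀ i j : Fin N, i < j → (I i ∩ I j).Nonempty →
          (((μ i).withDensity fun y =>
              ENNReal.ofReal (eval (extendZero (I i) y) (q i))).map
            (restrTo (I i) (I i ∩ I j) Finset.inter_subset_left) =
          ((μ j).withDensity fun y =>
              ENNReal.ofReal (eval (extendZero (I j) y) (q j))).map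
            (restrTo (I j) (I i ∩ I j) Finset.inter_subset_right))) ∧
        v = ∑ i, ∫ y, eval (extendZero (I i) y) (p i) ∂(μ i)} =
      sInf {v : ℝ | ∃ x ∈ {x : Fin n → ℝ | ∀ j, 0 ≤ eval x (g j)},
        v = ∑ i, eval x (p i) / eval x (q i)} := by
  set A := (Finset.univ.biUnion fun i' : Fin N => (p i').support ∪ (q i').support) ∪
    Finset.univ.biUnion fun j => (g j).support
  have hpA (i : Fin N) (r) (hr : r ∈ signSyms A) (x : Fin n → ℝ) :
      eval (signFlip r x) (p i) = eval x (p i) := by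
    simp only [signSyms, Finset.mem_filter, Finset.mem_univ, true_and] at hr
    refine eval_signFlip (fun α hα => hr α ?_) x
    exact Finset.mem_union_left _ (Finset.mem_biUnion.mpr
      ⟨i, Finset.mem_univ _, Finset.mem_union_left _ hα⟩)
  have hqA (i : Fin N) (r) (hr : r ∈ signSyms A) (x : Fin n → ℝ) :
      eval (signFlip r x) (q i) = eval x (q i) := by
    simp only [signSyms, Finset.mem_filter, Finset.mem_univ, true_and] at hr
    refine eval_signFlip (fun α hα => hr α ?_) x
    exact Finset.mem_union_left _ (Finset.mem_biUnion.mpr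
      ⟨i, Finset.mem_univ _, Finset.mem_union_right _ hα⟩)
  have hgA (j : Fin m) (r) (hr : r ∈ signSyms A) (x : Fin n → ℝ) :
      eval (signFlip r x) (g j) = eval x (g j) := by
    simp only [signSyms, Finset.mem_filter, Finset.mem_univ, true_and] at hr
    refine eval_signFlip (fun α hα => hr α ?_) x
    exact Finset.mem_union_right _ (Finset.mem_biUnion.mpr ⟨j, Finset.mem_univ _, hα⟩)
  have hrestr (S : Finset (Fin n)) :
      Measurable (S.restrict : (Fin n → ℝ) → ({l : Fin n // l ∈ S} → ℝ)) :=
    Finset.measurable_restrict S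
  have hKi (x : Fin n → ℝ) (hx : ∀ j, 0 ≤ eval x (g j)) (i : Fin N) :
      ∀ j ∈ J i, 0 ≤ eval (extendZero (I i) ((I i).restrict x)) (g j) := fun j hj => by
    rw [eval_extendZero_restrict (hg i j hj)]
    exact hx j
  have hqK (x : Fin n → ℝ) (hx : ∀ j, 0 ≤ eval x (g j)) (i : Fin N) : 0 < eval x (q i) := by
    rw [← eval_extendZero_restrict (hqv i)]
    exact hqpos i _ (hKi x hx i)
  have hbdd : BddBelow {v : ℝ | ∃ x ∈ {x : Fin n → ℝ | ∀ j, 0 ≤ eval x (g j)},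
      v = ∑ i, eval x (p i) / eval x (q i)} := by
    have hb (i : Fin N) := (isCompact_feasible g (I i) (J i) (hball i)).exists_bound_of_continuousOn
      ((continuous_eval_extendZero (I i) (p i)).continuousOn.div
        (continuous_eval_extendZero (I i) (q i)).continuousOn fun y hy => (hqpos i y hy).ne')
    choose C hC using hb
    refine ⟨∑ i, -C i, ?_⟩
    rintro v ⟨x, hx, rfl⟩
    refine Finset.sum_le_sum fun i _ => ?_
    have h := hC i _ (hKi x hx i)
    rw [Pi.div_apply, eval_extendZero_restrict (hp i), eval_extendZero_restrict (hqv i)] at h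
    exact (abs_le.mp h).1
  refine sInf_eq_of_subset_of_forall_le ?_ ?_ ?_
  · obtain ⟨x, hx⟩ := hKne
    exact ⟨_, x, hx, rfl⟩
  · rintro v ⟨x, hx, rfl⟩
    obtain ⟨π, hπ, horb, hinv⟩ := exists_invariant_orbit_measure A x
    have hqx (i : Fin N) : 0 < eval x (q i) := hqK x hx i
    have hconst (i : Fin N) (f : MvPolynomial (Fin n) ℝ) (hf : f.vars ⊆ I i)
        (hfA : ∀ r ∈ signSyms A, eval (signFlip r x) f = eval x f) :
        ∀ᵐ y ∂(π.map (I i).restrict), eval (extendZero (I i) y) f = eval x f := by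
      rw [ae_map_iff (hrestr _).aemeasurable (measurableSet_eq_fun
        (continuous_eval_extendZero _ _).measurable measurable_const)]
      filter_upwards [horb] with y ⟨r, hr, hy⟩
      rw [eval_extendZero_restrict hf, hy, hfA r hr]
    have hprob (i : Fin N) : IsProbabilityMeasure (π.map (I i).restrict) :=
      Measure.isProbabilityMeasure_map (hrestr _).aemeasurable
    have hdens (i : Fin N) : ((ENNReal.ofReal (eval x (q i))⁻¹ • π.map (I i).restrict).withDensity
        fun y => ENNReal.ofReal (eval (extendZero (I i) y) (q i))) = π.map (I i).restrict := by
      rw [withDensity_congr_ae (g := fun _ => ENNReal.ofReal (eval x (q i))), withDensity_const,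
        smul_smul, ← ENNReal.ofReal_mul (hqx i).le, mul_inv_cancel₀ (hqx i).ne',
        ENNReal.ofReal_one, one_smul]
      refine Measure.ae_smul_measure ?_ _
      filter_upwards [hconst i (q i) (hqv i) fun r hr => hqA i r hr x] with y hy
      rw [hy]
    have hintegral (i : Fin N) (f : MvPolynomial (Fin n) ℝ) (hf : f.vars ⊆ I i)
        (hfA : ∀ r ∈ signSyms A, eval (signFlip r x) f = eval x f) :
        ∫ y, eval (extendZero (I i) y) f
          ∂(ENNReal.ofReal (eval x (q i))⁻¹ • π.map (I i).restrict) =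
            eval x f / eval x (q i) := by
      rw [integral_smul_measure, integral_congr_ae (hconst i f hf hfA), integral_const,
        ENNReal.toReal_ofReal (inv_nonneg.mpr (hqx i).le)]
      simp [div_eq_inv_mul]
    refine ⟨fun i => ENNReal.ofReal (eval x (q i))⁻¹ • π.map (I i).restrict,
      fun i => Measure.smul_finite _ ENNReal.ofReal_ne_top, fun i => ?_, fun i r hr => ?_,
      fun i => ?_, fun i j _ _ => ?_, ?_⟩
    · change ∀ᵐ y ∂(ENNReal.ofReal (eval x (q i))⁻¹ • π.map (I i).restrict),
        ∀ j ∈ J i, 0 ≤ eval (extendZero (I i) y) (g j)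
      refine Measure.ae_smul_measure ?_ _
      rw [ae_map_iff (hrestr _).aemeasurable (isClosed_feasible g (I i) (J i)).measurableSet]
      filter_upwards [horb] with y ⟨r, hr, hy⟩
      refine hKi y (fun j => ?_) i
      rw [hy, hgA j r hr]
      exact hx j
    · have hcomm : flipOn (I i) r ∘ (I i).restrict = (I i).restrict ∘ signFlip r := rfl
      rw [Measure.map_smul, Measure.map_map (measurable_flipOn _ _) (hrestr _), hcomm,
        ← Measure.map_map (hrestr _) (measurable_signFlip r), hinv r hr]
    · rw [hintegral i (q i) (hqv i) fun r hr => hqA i r hr x, div_self (hqx i).ne']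
    · simp only [hdens]
      rw [Measure.map_map (measurable_restrTo _ _ _) (hrestr _),
        Measure.map_map (measurable_restrTo _ _ _) (hrestr _)]
      rfl
    · exact Finset.sum_congr rfl fun i _ =>
        (hintegral i (p i) (hp i) fun r hr => hpA i r hr x).symm
  · rintro v ⟨μ, -, hsupp, -, hone, hmarg, rfl⟩
    have hfacts (i : Fin N) := withDensity_integral_div
      (isCompact_feasible g (I i) (J i) (hball i)) (hsupp i)
      (continuous_eval_extendZero (I i) (p i)) (continuous_eval_extendZero (I i) (q i))
      (hqpos i) (hone i)
    have hprob (i : Fin N) := (hfacts i).1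
    obtain ⟨π, hπ, hmap⟩ := exists_measure_of_running_intersection I hRIP _ hmarg
    have hK : ∀ᵐ x ∂π, ∀ j, 0 ≤ eval x (g j) := by
      have h : ∀ᵐ x ∂π, ∀ i, ∀ j ∈ J i, 0 ≤ eval (extendZero (I i) ((I i).restrict x)) (g j) := by
        refine ae_all_iff.mpr fun i => ?_
        have h1 := (hfacts i).2.1
        rw [← hmap i] at h1
        exact ae_of_ae_map (hrestr _).aemeasurable h1
      filter_upwards [h] with x hx j
      obtain ⟨i, hi⟩ := hJcover j
      rw [← eval_extendZero_restrict (hg i j hi)]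
      exact hx i j hi
    have hdiv (i : Fin N) : Integrable (fun x => eval x (p i) / eval x (q i)) π ∧
        ∫ x, eval x (p i) / eval x (q i) ∂π = ∫ y, eval (extendZero (I i) y) (p i) ∂(μ i) := by
      obtain ⟨-, -, hint, heq⟩ := hfacts i
      have hsm : AEStronglyMeasurable (fun y => eval (extendZero (I i) y) (p i) /
          eval (extendZero (I i) y) (q i)) (π.map (I i).restrict) := hmap i ▸ hint.1
      rw [← hmap i] at hint heq
      rw [integrable_map_measure hsm (hrestr _).aemeasurable] at hint
      rw [integral_map (hrestr _).aemeasurable hsm] at heq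
      simp only [Function.comp_def, eval_extendZero_restrict (hp i),
        eval_extendZero_restrict (hqv i)] at hint heq
      exact ⟨hint, heq⟩
    simp_rw [← fun i => (hdiv i).2]
    rw [← integral_finsetSum _ fun i _ => (hdiv i).1]
    calc _ = ∫ _, sInf {v : ℝ | ∃ x ∈ {x : Fin n → ℝ | ∀ j, 0 ≤ eval x (g j)},
          v = ∑ i, eval x (p i) / eval x (q i)} ∂π := by simp
      _ ≤ _ := by
        refine integral_mono_ae (integrable_const _)
          (integrable_finsetSum _ fun i _ => (hdiv i).1) ?_
        filter_upwards [hK] with x hx using csInf_le hbdd ⟨x, hx, rfl⟩
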